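/- For every integer k ≥ 4 and every finite (possibly empty) word b of positive integers, the set C(b,k) = {[0; b, θ] : θ = (θ_n)_{n≥1} with θ_n ∈ {1,…,k} for all n} is a Cantor set whose thickness satisfies τ(C(b,k)) > 1. -/

import Mathlib

open Filter Set
open scoped Pointwise

noncomputable section

/-- The `n`-th convergent of the continued fraction `[0; a 0, a 1, a 2, …]`. -/
def cfConv : ℕ → (ℕ → ℕ) → ℝ
  | 0, _ => 0
  | n + 1, a => 1 / (a 0 + cfConv n fun i => a (i + 1))

/-- The value `[0; a 0, a 1, a 2, …]` of the infinite continued fraction with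
partial quotients `a 0, a 1, …` (the limit of its convergents). -/
def cfVal (a : ℕ → ℕ) : ℝ := limUnder atTop fun n => cfConv n a

/-- The sequence of partial quotients obtained by concatenating the finite word `b`
with the sequence `θ`. -/
def app (b : List ℕ) (θ : ℕ → ℕ) : ℕ → ℕ := fun n =>
  if h : n < b.length then b.get ⟨n, h⟩ else θ (n - b.length)

/-- `Ioo a b` is a bounded gap of the compact set `K`: a bounded connected
component of `ℝ \ K`. -/
def IsGap (K : Set ℝ) (a b : ℝ) : Prop :=
  a < b ∧ a ∈ K ∧ b ∈ K ∧ Set.Ioo a b ∩ K = ∅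

/-- The length of the left bridge of the gap `Ioo a b` of `K`: the length of the
closed interval between the gap and the nearest gap to its left of length at least
`b - a` (the unbounded gap `(-∞, sInf K)`, of infinite length, always qualifying). -/
def leftBridgeLen (K : Set ℝ) (a b : ℝ) : ℝ :=
  a - sSup ({sInf K} ∪ {d | ∃ c, IsGap K c d ∧ d ≤ a ∧ b - a ≤ d - c})

/-- The length of the right bridge of the gap `Ioo a b` of `K`. -/
def rightBridgeLen (K : Set ℝ) (a b : ℝ) : ℝ :=
  sInf ({sSup K} ∪ {c | ∃ d, IsGap K c d ∧ b ≤ c ∧ b - a ≤ d - c}) - b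

/-- The thickness of `K`: the infimum over bounded gaps `U` of
`min (|L_U|, |R_U|) / |U|`. -/
def thickness (K : Set ℝ) : ℝ :=
  sInf {r | ∃ a b, IsGap K a b ∧
    r = min (leftBridgeLen K a b) (rightBridgeLen K a b) / (b - a)}

/-- A Cantor set: a compact, perfect, totally disconnected subset of `ℝ`. -/
def IsCantorSet (K : Set ℝ) : Prop :=
  IsCompact K ∧ Perfect K ∧ IsTotallyDisconnected K

/-- `C(b,k) = {[0; b, θ] : θ_n ∈ {1,…,k} for all n}`. -/
def Cbk (k : ℕ) (b : List ℕ) : Set ℝ :=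
  {x | ∃ θ : ℕ → ℕ, (∀ n, 1 ≤ θ n ∧ θ n ≤ k) ∧ x = cfVal (app b θ)}

lemma cfConv_mem_Icc (n : ℕ) (a : ℕ → ℕ) (ha : ∀ n, 1 ≤ a n) : cfConv n a ∈ Icc (0 : ℝ) 1 := by
  induction n generalizing a with
  | zero => simp [cfConv]
  | succ n ih =>
    have h := ih (fun i => a (i + 1)) fun i => ha _
    have h1 : (1 : ℝ) ≤ a 0 := by exact_mod_cast ha 0
    simp only [cfConv, mem_Icc] at h ⊢
    refine ⟨by have := h.1; positivity, ?_⟩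
    rw [div_le_one (by linarith)]
    linarith

lemma abs_inv_add_inv_sub_le {a b x y : ℝ} (ha : 1 ≤ a) (hb : 1 ≤ b) (hx : 0 ≤ x) (hy : 0 ≤ y) :
    |1 / (a + 1 / (b + x)) - 1 / (a + 1 / (b + y))| ≤ |x - y| / 4 := by
  have h : 1 / (a + 1 / (b + x)) - 1 / (a + 1 / (b + y))
      = (x - y) / ((a * (b + x) + 1) * (a * (b + y) + 1)) := by
    have h1 : a * (b + x) + 1 ≠ 0 := by positivity
    have h2 : a * (b + y) + 1 ≠ 0 := by positivity
    have h3 : b + x ≠ 0 := by positivity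
    have h4 : b + y ≠ 0 := by positivity
    have h5 : a + 1 / (b + x) = (a * (b + x) + 1) / (b + x) := by field_simp
    have h6 : a + 1 / (b + y) = (a * (b + y) + 1) / (b + y) := by field_simp
    rw [h5, h6, one_div_div, one_div_div]
    field_simp
    ring
  have h1 : 2 ≤ a * (b + x) + 1 := by nlinarith
  have h2 : 2 ≤ a * (b + y) + 1 := by nlinarith
  have h3 : 4 ≤ (a * (b + x) + 1) * (a * (b + y) + 1) := by nlinarith
  rw [h, abs_div, abs_of_pos (by linarith : 0 < (a * (b + x) + 1) * (a * (b + y) + 1))]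
  exact div_le_div_of_nonneg_left (abs_nonneg _) (by norm_num) h3

lemma abs_cfConv_sub_le (N : ℕ) : ∀ (a a' : ℕ → ℕ) (n n' : ℕ), (∀ n, 1 ≤ a n) → (∀ n, 1 ≤ a' n) →
    (∀ i < N, a i = a' i) → N ≤ n → N ≤ n' →
    |cfConv n a - cfConv n' a'| ≤ 2 * (1 / 2) ^ N := by
  induction N using Nat.twoStepInduction with
  | zero =>
    intro a a' n n' ha ha' _ _ _
    have h := cfConv_mem_Icc n a ha
    have h' := cfConv_mem_Icc n' a' ha'
    rw [abs_le]
    constructor <;> linarith [h.1, h.2, h'.1, h'.2]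
  | one =>
    intro a a' n n' ha ha' _ _ _
    have h := cfConv_mem_Icc n a ha
    have h' := cfConv_mem_Icc n' a' ha'
    rw [abs_le]
    constructor <;> linarith [h.1, h.2, h'.1, h'.2]
  | more N ih _ =>
    intro a a' n n' ha ha' h hn hn'
    obtain ⟨n, rfl⟩ := Nat.exists_eq_add_of_le' (le_trans (Nat.le_add_left 2 N) hn)
    obtain ⟨n', rfl⟩ := Nat.exists_eq_add_of_le' (le_trans (Nat.le_add_left 2 N) hn')
    have h0 : a 0 = a' 0 := h 0 (by omega)
    have h1 : a 1 = a' 1 := h 1 (by omega)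
    have hr := ih (fun i => a (i + 1 + 1)) (fun i => a' (i + 1 + 1)) n n' (fun _ => ha _)
      (fun _ => ha' _) (fun i hi => h _ (by omega)) (by omega) (by omega)
    have hc := abs_inv_add_inv_sub_le (a := a' 0) (b := a' 1) (by exact_mod_cast ha' 0)
      (by exact_mod_cast ha' 1) (cfConv_mem_Icc n (fun i => a (i + 1 + 1)) fun _ => ha _).1
      (cfConv_mem_Icc n' (fun i => a' (i + 1 + 1)) fun _ => ha' _).1
    simp only [cfConv, zero_add, h0, h1]
    refine hc.trans ?_
    rw [pow_add]
    linarith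

lemma tendsto_cfVal (a : ℕ → ℕ) (ha : ∀ n, 1 ≤ a n) :
    Tendsto (fun n => cfConv n a) atTop (nhds (cfVal a)) := by
  have hc : CauchySeq fun n => cfConv n a := by
    refine cauchySeq_of_le_tendsto_0' (fun N => 2 * (1 / 2 : ℝ) ^ N) (fun n m h => ?_) ?_
    · rw [Real.dist_eq]
      exact abs_cfConv_sub_le n a a n m ha ha (fun _ _ => rfl) le_rfl h
    · simpa using (tendsto_pow_atTop_nhds_zero_of_lt_one (r := (1 / 2 : ℝ)) (by norm_num)
        (by norm_num)).const_mul 2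
  exact tendsto_nhds_limUnder (cauchySeq_tendsto_of_complete hc)

lemma cfVal_mem_Icc (a : ℕ → ℕ) (ha : ∀ n, 1 ≤ a n) : cfVal a ∈ Icc (0 : ℝ) 1 :=
  isClosed_Icc.mem_of_tendsto (tendsto_cfVal a ha)
    (Eventually.of_forall fun n => cfConv_mem_Icc n a ha)

lemma abs_cfVal_sub_le (N : ℕ) (a a' : ℕ → ℕ) (ha : ∀ n, 1 ≤ a n) (ha' : ∀ n, 1 ≤ a' n)
    (h : ∀ i < N, a i = a' i) : |cfVal a - cfVal a'| ≤ 2 * (1 / 2) ^ N :=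
  le_of_tendsto ((tendsto_cfVal a ha).sub (tendsto_cfVal a' ha')).abs
    (eventually_atTop.2 ⟨N, fun n hn => abs_cfConv_sub_le N a a' n n ha ha' h hn hn⟩)

lemma cfVal_eq (a : ℕ → ℕ) (ha : ∀ n, 1 ≤ a n) :
    cfVal a = 1 / (a 0 + cfVal fun i => a (i + 1)) := by
  have h1 := (tendsto_add_atTop_iff_nat 1).2 (tendsto_cfVal a ha)
  have h2 := tendsto_cfVal (fun i => a (i + 1)) fun _ => ha _
  have h0 : (1 : ℝ) ≤ a 0 := by exact_mod_cast ha 0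
  have hn := (cfVal_mem_Icc (fun i => a (i + 1)) fun _ => ha _).1
  refine tendsto_nhds_unique h1 ?_
  exact tendsto_const_nhds.div (h2.const_add (a 0 : ℝ)) (by positivity)

lemma cfVal_pos (a : ℕ → ℕ) (ha : ∀ n, 1 ≤ a n) : 0 < cfVal a := by
  have h0 : (1 : ℝ) ≤ a 0 := by exact_mod_cast ha 0
  have hn := (cfVal_mem_Icc (fun i => a (i + 1)) fun _ => ha _).1
  rw [cfVal_eq a ha]
  positivity

lemma cfVal_lt_one (a : ℕ → ℕ) (ha : ∀ n, 1 ≤ a n) : cfVal a < 1 := by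
  have h0 : (1 : ℝ) ≤ a 0 := by exact_mod_cast ha 0
  have hn := cfVal_pos (fun i => a (i + 1)) fun _ => ha _
  rw [cfVal_eq a ha, div_lt_one (by positivity)]
  linarith

lemma cfVal_inj (n : ℕ) : ∀ a a' : ℕ → ℕ, (∀ n, 1 ≤ a n) → (∀ n, 1 ≤ a' n) →
    cfVal a = cfVal a' → a n = a' n := by
  have key : ∀ a a' : ℕ → ℕ, (∀ n, 1 ≤ a n) → (∀ n, 1 ≤ a' n) → cfVal a = cfVal a' →
      a 0 = a' 0 ∧ cfVal (fun i => a (i + 1)) = cfVal fun i => a' (i + 1) := by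
    intro a a' ha ha' h
    have hp := cfVal_pos (fun i => a (i + 1)) fun _ => ha _
    have hp' := cfVal_pos (fun i => a' (i + 1)) fun _ => ha' _
    have hl := cfVal_lt_one (fun i => a (i + 1)) fun _ => ha _
    have hl' := cfVal_lt_one (fun i => a' (i + 1)) fun _ => ha' _
    rw [cfVal_eq a ha, cfVal_eq a' ha', one_div, one_div, inv_inj] at h
    have h1 : (a 0 : ℝ) < a' 0 + 1 := by linarith
    have h2 : (a' 0 : ℝ) < a 0 + 1 := by linarith
    have h3 : a 0 = a' 0 := by
      have h1 : a 0 < a' 0 + 1 := by exact_mod_cast h1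
      have h2 : a' 0 < a 0 + 1 := by exact_mod_cast h2
      omega
    rw [h3] at h
    exact ⟨h3, by linarith⟩
  induction n with
  | zero => exact fun a a' ha ha' h => (key a a' ha ha' h).1
  | succ n ih =>
    exact fun a a' ha ha' h => ih (fun i => a (i + 1)) (fun i => a' (i + 1)) (fun _ => ha _)
      (fun _ => ha' _) (key a a' ha ha' h).2

lemma cfVal_mul_ne (q : ℕ) : ∀ (p : ℤ) (a : ℕ → ℕ), (∀ n, 1 ≤ a n) → 0 < q →
    cfVal a * q ≠ p := by
  induction q using Nat.strong_induction_on with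
  | _ q ih =>
    intro p a ha hq h
    have hq' : (0 : ℝ) < q := by exact_mod_cast hq
    have hp := cfVal_pos a ha
    have hl := cfVal_lt_one a ha
    have hs := cfVal_pos (fun i => a (i + 1)) fun _ => ha _
    have hp0 : 0 < p := by
      have : (0 : ℝ) < p := by rw [← h]; positivity
      exact_mod_cast this
    have hpq : p < q := by
      have : (p : ℝ) < q := by rw [← h]; nlinarith
      exact_mod_cast this
    lift p to ℕ using hp0.le
    refine ih p (by exact_mod_cast hpq) (q - a 0 * p) (fun i => a (i + 1)) (fun _ => ha _)
      (by exact_mod_cast hp0) ?_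
    have he := cfVal_eq a ha
    rw [eq_div_iff (by positivity)] at he
    push_cast at h ⊢
    rw [← h]
    linear_combination (q : ℝ) * he

lemma irrational_cfVal (a : ℕ → ℕ) (ha : ∀ n, 1 ≤ a n) : Irrational (cfVal a) := by
  rintro ⟨r, hr⟩
  refine cfVal_mul_ne r.den r.num a ha r.pos ?_
  rw [← hr]
  exact_mod_cast r.mul_den_eq_num

lemma one_le_app {b : List ℕ} (hb : ∀ d ∈ b, 1 ≤ d) {θ : ℕ → ℕ} (hθ : ∀ n, 1 ≤ θ n) (n : ℕ) :
    1 ≤ app b θ n := by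
  unfold app
  split_ifs
  · exact hb _ (List.get_mem _ _)
  · exact hθ _

lemma app_nil (θ : ℕ → ℕ) : app [] θ = θ := by
  funext n
  simp [app]

lemma app_cons_zero (d : ℕ) (b : List ℕ) (θ : ℕ → ℕ) : app (d :: b) θ 0 = d := by
  simp [app]

lemma app_cons_succ (d : ℕ) (b : List ℕ) (θ : ℕ → ℕ) :
    (fun i => app (d :: b) θ (i + 1)) = app b θ := by
  funext i
  simp [app]

lemma app_add_length (b : List ℕ) (θ : ℕ → ℕ) (n : ℕ) : app b θ (n + b.length) = θ n := by
  simp [app]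

lemma mem_Cbk_cons {k d : ℕ} {b : List ℕ} (hd : 1 ≤ d) (hb : ∀ d ∈ b, 1 ≤ d) {x : ℝ} :
    x ∈ Cbk k (d :: b) ↔ ∃ y ∈ Cbk k b, x = 1 / (d + y) := by
  have h : ∀ θ : ℕ → ℕ, (∀ n, 1 ≤ θ n ∧ θ n ≤ k) →
      cfVal (app (d :: b) θ) = 1 / (d + cfVal (app b θ)) := by
    intro θ hθ
    rw [cfVal_eq _ (one_le_app (by simpa using ⟨hd, hb⟩) fun n => (hθ n).1), app_cons_zero,
      app_cons_succ]
  constructor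
  · rintro ⟨θ, hθ, rfl⟩
    exact ⟨_, ⟨θ, hθ, rfl⟩, h θ hθ⟩
  · rintro ⟨_, ⟨θ, hθ, rfl⟩, rfl⟩
    exact ⟨θ, hθ, (h θ hθ).symm⟩

lemma mem_Cbk_nil {k : ℕ} {x : ℝ} :
    x ∈ Cbk k [] ↔ ∃ i : ℕ, 1 ≤ i ∧ i ≤ k ∧ ∃ y ∈ Cbk k [], x = 1 / (i + y) := by
  constructor
  · rintro ⟨θ, hθ, rfl⟩
    refine ⟨θ 0, (hθ 0).1, (hθ 0).2, _, ⟨fun i => θ (i + 1), fun _ => hθ _, rfl⟩, ?_⟩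
    rw [app_nil, app_nil]
    exact cfVal_eq θ fun n => (hθ n).1
  · rintro ⟨i, h1, h2, _, ⟨θ, hθ, rfl⟩, rfl⟩
    refine ⟨fun n => Nat.casesOn n i θ, fun n => ?_, ?_⟩
    · cases n
      exacts [⟨h1, h2⟩, hθ _]
    · rw [app_nil, app_nil]
      refine (cfVal_eq (fun n => Nat.casesOn n i θ) fun n => ?_).symm
      cases n
      exacts [h1, (hθ _).1]

lemma Cbk_subset_Icc {k : ℕ} {b : List ℕ} (hb : ∀ d ∈ b, 1 ≤ d) : Cbk k b ⊆ Icc 0 1 := by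
  rintro _ ⟨θ, hθ, rfl⟩
  exact cfVal_mem_Icc _ (one_le_app hb fun n => (hθ n).1)

lemma irrational_of_mem_Cbk {k : ℕ} {b : List ℕ} (hb : ∀ d ∈ b, 1 ≤ d) {x : ℝ}
    (hx : x ∈ Cbk k b) : Irrational x := by
  obtain ⟨θ, hθ, rfl⟩ := hx
  exact irrational_cfVal _ (one_le_app hb fun n => (hθ n).1)

lemma abs_cfVal_app_sub_le (N : ℕ) {b : List ℕ} (hb : ∀ d ∈ b, 1 ≤ d) {θ θ' : ℕ → ℕ}
    (hθ : ∀ n, 1 ≤ θ n) (hθ' : ∀ n, 1 ≤ θ' n) (h : ∀ i < N, θ i = θ' i) :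
    |cfVal (app b θ) - cfVal (app b θ')| ≤ 2 * (1 / 2) ^ N := by
  refine abs_cfVal_sub_le N _ _ (one_le_app hb hθ) (one_le_app hb hθ') fun i hi => ?_
  unfold app
  split_ifs
  · rfl
  · exact h _ (by omega)

lemma exists_two_mul_half_pow_lt {ε : ℝ} (hε : 0 < ε) : ∃ N : ℕ, 2 * (1 / 2 : ℝ) ^ N < ε := by
  obtain ⟨N, hN⟩ := exists_pow_lt_of_lt_one (half_pos hε) (by norm_num : (1 / 2 : ℝ) < 1)
  exact ⟨N, by linarith⟩

lemma isCompact_Cbk (k : ℕ) {b : List ℕ} (hb : ∀ d ∈ b, 1 ≤ d) : IsCompact (Cbk k b) := by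
  have hS : IsCompact (univ.pi fun _ : ℕ => Icc 1 k) :=
    isCompact_univ_pi fun _ => (finite_Icc 1 k).isCompact
  have hc : ContinuousOn (fun θ => cfVal (app b θ)) (univ.pi fun _ : ℕ => Icc 1 k) := by
    intro θ hθ
    refine Metric.tendsto_nhds.2 fun ε hε => ?_
    obtain ⟨N, hN⟩ := exists_two_mul_half_pow_lt hε
    have hn : ∀ᶠ θ' in nhds θ, ∀ i ∈ Finset.range N, θ' i = θ i := by
      refine (Finset.eventually_all _).2 fun i _ => ?_
      have h : Tendsto (fun θ' : ℕ → ℕ => θ' i) (nhds θ) (nhds (θ i)) :=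
        (continuous_apply i).tendsto θ
      rw [nhds_discrete ℕ] at h
      exact tendsto_pure.1 h
    filter_upwards [nhdsWithin_le_nhds hn, self_mem_nhdsWithin] with θ' h1 h2
    rw [Real.dist_eq]
    refine (abs_cfVal_app_sub_le N hb (fun n => (h2 n trivial).1) (fun n => (hθ n trivial).1)
      fun i hi => h1 i (Finset.mem_range.2 hi)).trans_lt hN
  have h := hS.image_of_continuousOn hc
  convert h using 1
  ext x
  simp only [Cbk, mem_ofPred_eq, mem_image, mem_univ_pi, mem_Icc, eq_comm]

lemma exists_ne_mem_Cbk {k : ℕ} (hk : 2 ≤ k) {b : List ℕ} (hb : ∀ d ∈ b, 1 ≤ d) {x ε : ℝ}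
    (hx : x ∈ Cbk k b) (hε : 0 < ε) : ∃ y ∈ Cbk k b, y ≠ x ∧ |y - x| < ε := by
  obtain ⟨θ, hθ, rfl⟩ := hx
  obtain ⟨N, hN⟩ := exists_two_mul_half_pow_lt hε
  have hθ' : ∀ n, 1 ≤ Function.update θ N (if θ N = 1 then 2 else 1) n ∧
      Function.update θ N (if θ N = 1 then 2 else 1) n ≤ k := by
    intro n
    rcases eq_or_ne n N with rfl | hn
    · rw [Function.update_self]
      split_ifs <;> omega
    · rw [Function.update_of_ne hn]
      exact hθ n
  refine ⟨_, ⟨_, hθ', rfl⟩, fun h => ?_, ?_⟩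
  · have := cfVal_inj (N + b.length) _ _ (one_le_app hb fun n => (hθ' n).1)
      (one_le_app hb fun n => (hθ n).1) h
    rw [app_add_length, app_add_length, Function.update_self] at this
    split_ifs at this <;> omega
  · refine (abs_cfVal_app_sub_le N hb (fun n => (hθ' n).1) (fun n => (hθ n).1)
      fun i hi => ?_).trans_lt hN
    rw [Function.update_of_ne hi.ne]

lemma Cbk_nonempty {k : ℕ} (hk : 1 ≤ k) (b : List ℕ) : (Cbk k b).Nonempty :=
  ⟨_, fun _ => 1, fun _ => ⟨le_rfl, hk⟩, rfl⟩

lemma isCantorSet_Cbk {k : ℕ} (hk : 2 ≤ k) {b : List ℕ} (hb : ∀ d ∈ b, 1 ≤ d) :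
    IsCantorSet (Cbk k b) := by
  refine ⟨isCompact_Cbk k hb, ⟨(isCompact_Cbk k hb).isClosed, fun x hx => ?_⟩, ?_⟩
  · rw [accPt_iff_nhds]
    intro U hU
    obtain ⟨ε, hε, hU⟩ := Metric.mem_nhds_iff.1 hU
    obtain ⟨y, hy, hne, hd⟩ := exists_ne_mem_Cbk hk hb hx hε
    exact ⟨y, ⟨hU (by rwa [Metric.mem_ball, Real.dist_eq]), hy⟩, hne⟩
  · intro t ht hc x hx y hy
    by_contra hne
    wlog hlt : x < y generalizing x y
    · exact this hy hx (Ne.symm hne) (lt_of_le_of_ne (not_lt.1 hlt) (Ne.symm hne))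
    obtain ⟨q, hq1, hq2⟩ := exists_rat_btwn hlt
    exact irrational_of_mem_Cbk hb (ht (hc.ordConnected.out hx hy ⟨hq1.le, hq2.le⟩)) ⟨q, rfl⟩

lemma exists_isGap {K : Set ℝ} (hK : IsCompact K) {x y q : ℝ} (hx : x ∈ K) (hy : y ∈ K)
    (hxq : x < q) (hqy : q < y) (hq : q ∉ K) : ∃ u v, IsGap K u v := by
  obtain ⟨u, hu, hu'⟩ := (hK.inter_right isClosed_Iic).exists_isGreatest ⟨x, hx, hxq.le⟩
  obtain ⟨v, hv, hv'⟩ := (hK.inter_right isClosed_Ici).exists_isLeast ⟨y, hy, hqy.le⟩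
  have huq : u ≠ q := fun h => hq (h ▸ hu.1)
  refine ⟨u, v, lt_of_lt_of_le (lt_of_le_of_ne hu.2 huq) hv.2, hu.1, hv.1, ?_⟩
  refine eq_empty_of_forall_notMem fun z hz => ?_
  rcases le_total z q with h | h
  · exact absurd (hu' ⟨hz.2, h⟩) (not_le.2 hz.1.1)
  · exact absurd (hv' ⟨hz.2, h⟩) (not_le.2 hz.1.2)

/-- The length of the image of `[x, y]` under a Möbius map whose derivative is proportional to
`t ↦ (1 + β * t)⁻²`, up to the constant of proportionality. -/
def mobiusLen (β x y : ℝ) : ℝ := (y - x) / ((1 + β * x) * (1 + β * y))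

/-- The gap `Ioo u v` of `K` has bridges reaching at least to `u' ≤ u` and `v' ≥ v`, both at least
`κ` times as long as the gap, where lengths are measured by `mobiusLen β`. -/
def HasBridges (κ β : ℝ) (K : Set ℝ) (u v : ℝ) : Prop :=
  ∃ u' ∈ K, ∃ v' ∈ K, u' ≤ u ∧ v ≤ v' ∧
    (∀ c d, IsGap K c d → u' ≤ c → d ≤ u → mobiusLen β c d < mobiusLen β u v) ∧
    (∀ c d, IsGap K c d → v ≤ c → d ≤ v' → mobiusLen β c d < mobiusLen β u v) ∧
    κ * mobiusLen β u v ≤ mobiusLen β u' u ∧ κ * mobiusLen β u v ≤ mobiusLen β v v'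

lemma mobiusLen_zero (x y : ℝ) : mobiusLen 0 x y = y - x := by simp [mobiusLen]

lemma mobiusLen_inv_add {a β x y : ℝ} (ha : 1 ≤ a) (hβ : 0 ≤ β) (hx : 0 ≤ x) (hy : 0 ≤ y) :
    mobiusLen β (1 / (a + y)) (1 / (a + x)) = (y - x) / ((a + β + x) * (a + β + y)) := by
  have h1 : a + x ≠ 0 := by positivity
  have h2 : a + y ≠ 0 := by positivity
  have h3 : a + β + x ≠ 0 := by positivity
  have h4 : a + β + y ≠ 0 := by positivity
  have h5 : 1 + β * (1 / (a + y)) = (a + β + y) / (a + y) := by field_simp; ring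
  have h6 : 1 + β * (1 / (a + x)) = (a + β + x) / (a + x) := by field_simp; ring
  rw [mobiusLen, h5, h6]
  field_simp
  ring

lemma mobiusLen_one_div {a β x y : ℝ} (ha : 1 ≤ a) (hβ : 0 ≤ β) (hx : 0 ≤ x) (hy : 0 ≤ y) :
    mobiusLen β (1 / (a + y)) (1 / (a + x)) = mobiusLen (1 / (a + β)) x y / (a + β) ^ 2 := by
  have h3 : a + β + x ≠ 0 := by positivity
  have h4 : a + β + y ≠ 0 := by positivity
  have h5 : a + β ≠ 0 := by positivity
  have h6 : 1 + 1 / (a + β) * x = (a + β + x) / (a + β) := by field_simp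
  have h7 : 1 + 1 / (a + β) * y = (a + β + y) / (a + β) := by field_simp
  rw [mobiusLen_inv_add ha hβ hx hy, mobiusLen, h6, h7]
  field_simp

lemma IsGap.exists_of_one_div_add {K K' : Set ℝ} {a m M c d : ℝ} (ha : 1 ≤ a) (hm : 0 ≤ m)
    (hM : 0 ≤ M) (hK : ∀ x ∈ Icc m M, 1 / (a + x) ∈ K' ↔ x ∈ K) (h : IsGap K' c d)
    (hc : 1 / (a + M) ≤ c) (hd : d ≤ 1 / (a + m)) :
    ∃ x y, c = 1 / (a + y) ∧ d = 1 / (a + x) ∧ m ≤ x ∧ y ≤ M ∧ IsGap K x y := by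
  obtain ⟨hcd, hcK, hdK, he⟩ := h
  have hM0 : 0 < a + M := by linarith
  have hm0 : 0 < a + m := by linarith
  have hc0 : 0 < c := lt_of_lt_of_le (by positivity) hc
  have hd0 : 0 < d := hc0.trans hcd
  have hxy : 1 / d - a < 1 / c - a := sub_lt_sub_right (one_div_lt_one_div_of_lt hc0 hcd) a
  have hmx : m ≤ 1 / d - a := by
    rw [le_sub_iff_add_le, add_comm]
    exact (le_one_div hd0 hm0).1 hd
  have hyM : 1 / c - a ≤ M := by
    rw [sub_le_iff_le_add, add_comm]
    exact (one_div_le hM0 hc0).1 hc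
  have hc' : c = 1 / (a + (1 / c - a)) := by rw [add_sub_cancel, one_div_one_div]
  have hd' : d = 1 / (a + (1 / d - a)) := by rw [add_sub_cancel, one_div_one_div]
  refine ⟨1 / d - a, 1 / c - a, hc', hd', hmx, hyM, hxy, ?_, ?_, ?_⟩
  · exact (hK _ ⟨hmx, hxy.le.trans hyM⟩).1 (hd' ▸ hdK)
  · exact (hK _ ⟨hmx.trans hxy.le, hyM⟩).1 (hc' ▸ hcK)
  · refine eq_empty_of_forall_notMem fun z hz => ?_
    have hzm : z ∈ Icc m M := ⟨hmx.trans hz.1.1.le, hz.1.2.le.trans hyM⟩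
    have hz0 : 0 < a + z := by linarith [hzm.1]
    refine eq_empty_iff_forall_notMem.1 he (1 / (a + z)) ⟨⟨?_, ?_⟩, (hK z hzm).2 hz.2⟩
    · rw [hc']
      exact one_div_lt_one_div_of_lt hz0 (by linarith [hz.1.2])
    · rw [hd']
      exact one_div_lt_one_div_of_lt (by linarith) (by linarith [hz.1.1])

lemma HasBridges.one_div_add {κ β a m M x y : ℝ} {K K' : Set ℝ} (ha : 1 ≤ a) (hβ : 0 ≤ β)
    (hm : 0 ≤ m) (hM : 0 ≤ M) (hKI : K ⊆ Icc m M)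
    (hK : ∀ x ∈ Icc m M, 1 / (a + x) ∈ K' ↔ x ∈ K) (hg : IsGap K x y)
    (h : HasBridges κ (1 / (a + β)) K x y) :
    HasBridges κ β K' (1 / (a + y)) (1 / (a + x)) := by
  obtain ⟨u, hu, v, hv, hux, hyv, hgu, hgv, hlu, hlv⟩ := h
  have hu0 : 0 ≤ u := hm.trans (hKI hu).1
  have hv0 : 0 ≤ v := hm.trans (hKI hv).1
  have hx0 : 0 ≤ x := hu0.trans hux
  have hy0 : 0 ≤ y := hx0.trans hg.1.le
  have hab : 0 < (a + β) ^ 2 := by positivity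
  have inv_le : ∀ {s t : ℝ}, 0 ≤ s → 0 ≤ t → 1 / (a + s) ≤ 1 / (a + t) → t ≤ s := by
    intro s t hs ht hst
    have := (one_div_le_one_div (by linarith) (by linarith)).1 hst
    linarith
  refine ⟨1 / (a + v), (hK v (hKI hv)).2 hv, 1 / (a + u), (hK u (hKI hu)).2 hu,
    one_div_le_one_div_of_le (by linarith) (by linarith),
    one_div_le_one_div_of_le (by linarith) (by linarith), ?_, ?_, ?_, ?_⟩
  · intro c d hcd hc hd
    obtain ⟨s, t, rfl, rfl, hs, ht, hst⟩ := hcd.exists_of_one_div_add ha hm hM hK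
      ((one_div_le_one_div_of_le (by linarith) (by linarith [(hKI hv).2])).trans hc)
      (hd.trans (one_div_le_one_div_of_le (by linarith) (by linarith [(hKI hg.2.2.1).1])))
    have hs0 := hm.trans hs
    have ht0 := hs0.trans hst.1.le
    rw [mobiusLen_one_div ha hβ hs0 ht0, mobiusLen_one_div ha hβ hx0 hy0]
    exact div_lt_div_of_pos_right (hgv s t hst (inv_le hs0 hy0 hd) (inv_le hv0 ht0 hc)) hab
  · intro c d hcd hc hd
    obtain ⟨s, t, rfl, rfl, hs, ht, hst⟩ := hcd.exists_of_one_div_add ha hm hM hK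
      ((one_div_le_one_div_of_le (by linarith) (by linarith [(hKI hg.2.1).2])).trans hc)
      (hd.trans (one_div_le_one_div_of_le (by linarith) (by linarith [(hKI hu).1])))
    have hs0 := hm.trans hs
    have ht0 := hs0.trans hst.1.le
    rw [mobiusLen_one_div ha hβ hs0 ht0, mobiusLen_one_div ha hβ hx0 hy0]
    exact div_lt_div_of_pos_right (hgu s t hst (inv_le hs0 hu0 hd) (inv_le hx0 ht0 hc)) hab
  · rw [mobiusLen_one_div ha hβ hx0 hy0, mobiusLen_one_div ha hβ hy0 hv0, ← mul_div_assoc]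
    exact div_le_div_of_nonneg_right hlv hab.le
  · rw [mobiusLen_one_div ha hβ hx0 hy0, mobiusLen_one_div ha hβ hu0 hx0, ← mul_div_assoc]
    exact div_le_div_of_nonneg_right hlu hab.le

lemma le_thickness {K : Set ℝ} {κ : ℝ} (hK : IsCompact K) (hne : ∃ u v, IsGap K u v)
    (h : ∀ u v, IsGap K u v → HasBridges κ 0 K u v) : κ ≤ thickness K := by
  obtain ⟨u₀, v₀, h₀⟩ := hne
  refine le_csInf ⟨_, u₀, v₀, h₀, rfl⟩ ?_
  rintro _ ⟨u, v, hg, rfl⟩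
  obtain ⟨p, hp, q, hq, huu, hvv, hgu, hgv, hlu, hlv⟩ := h u v hg
  simp only [mobiusLen_zero] at hgu hgv hlu hlv
  rw [le_div_iff₀ (sub_pos.2 hg.1), le_min_iff]
  constructor
  · refine hlu.trans (sub_le_sub_left (csSup_le (singleton_nonempty _).inl ?_) u)
    rintro d (rfl | ⟨c, hcd, hdu, hl⟩)
    · exact csInf_le hK.bddBelow hp
    · by_contra! hd
      refine (hgu c d hcd ?_ hdu).not_ge hl
      by_contra! hc
      exact eq_empty_iff_forall_notMem.1 hcd.2.2.2 p ⟨⟨hc, hd⟩, hp⟩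
  · refine hlv.trans (sub_le_sub_right (le_csInf (singleton_nonempty _).inl ?_) v)
    rintro c (rfl | ⟨d, hcd, hvc, hl⟩)
    · exact le_csSup hK.bddAbove hq
    · by_contra! hc
      refine (hgv c d hcd hvc ?_).not_ge hl
      by_contra! hd
      exact eq_empty_iff_forall_notMem.1 hcd.2.2.2 q ⟨⟨hc, hd⟩, hq⟩

/-- `m` and `M` are the extreme points of `C(∅,k)`, with the relations satisfied by
`[0; k, 1, k, 1, …]` and `[0; 1, k, 1, k, …]`. -/
structure Extremes (k : ℕ) (m M : ℝ) : Prop where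
  least : IsLeast (Cbk k []) m
  greatest : IsGreatest (Cbk k []) M
  pos : 0 < m
  lt : m < M
  lt_one : M < 1
  mul_max : M * (1 + m) = 1
  mul_min : m * (k + M) = 1

lemma exists_extremes {k : ℕ} (hk : 2 ≤ k) : ∃ m M, Extremes k m M := by
  have hb : ∀ d ∈ ([] : List ℕ), 1 ≤ d := by simp
  have hC := isCompact_Cbk k hb
  obtain ⟨m, hm⟩ := hC.exists_isLeast (Cbk_nonempty (by omega) _)
  obtain ⟨M, hM⟩ := hC.exists_isGreatest (Cbk_nonempty (by omega) _)
  have hpos : ∀ x ∈ Cbk k [], 0 < x ∧ x < 1 := by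
    rintro _ ⟨θ, hθ, rfl⟩
    exact ⟨cfVal_pos _ (one_le_app hb fun n => (hθ n).1),
      cfVal_lt_one _ (one_le_app hb fun n => (hθ n).1)⟩
  have hm0 := (hpos m hm.1).1
  have hM0 := (hpos M hM.1).1
  have hk' : (2 : ℝ) ≤ k := by exact_mod_cast hk
  have h1 : 1 / ((1 : ℕ) + m) ∈ Cbk k [] := mem_Cbk_nil.2 ⟨1, le_rfl, by omega, m, hm.1, rfl⟩
  have h2 : 1 / (k + M) ∈ Cbk k [] := mem_Cbk_nil.2 ⟨k, by omega, le_rfl, M, hM.1, rfl⟩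
  rw [Nat.cast_one] at h1
  have h3 : M = 1 / (1 + m) := by
    refine le_antisymm ?_ (hM.2 h1)
    obtain ⟨i, hi, -, y, hy, h⟩ := mem_Cbk_nil.1 hM.1
    rw [h]
    have hi' : (1 : ℝ) ≤ i := by exact_mod_cast hi
    exact one_div_le_one_div_of_le (by linarith) (by linarith [hm.2 hy])
  have h4 : m = 1 / (k + M) := by
    refine le_antisymm (hm.2 h2) ?_
    obtain ⟨i, hi, hi', y, hy, h⟩ := mem_Cbk_nil.1 hm.1
    rw [h]
    have hi' : (i : ℝ) ≤ k := by exact_mod_cast hi'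
    have hi0 : (1 : ℝ) ≤ i := by exact_mod_cast hi
    exact one_div_le_one_div_of_le (by linarith [(hpos y hy).1]) (by linarith [hM.2 hy])
  rw [eq_div_iff (by positivity)] at h3 h4
  exact ⟨m, M, hm, hM, hm0, by nlinarith, (hpos M hM.1).2, h3, h4⟩

namespace Extremes

variable {k : ℕ} {m M : ℝ}

lemma one_div_mem_iff (h : Extremes k m M) {i : ℕ} (hi : 1 ≤ i) (hik : i ≤ k) :
    ∀ x ∈ Icc m M, 1 / ((i : ℝ) + x) ∈ Cbk k [] ↔ x ∈ Cbk k [] := by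
  intro x hx
  refine ⟨fun hx' => ?_, fun hx' => mem_Cbk_nil.2 ⟨i, hi, hik, x, hx', rfl⟩⟩
  obtain ⟨j, hj, -, y, hy, he⟩ := mem_Cbk_nil.1 hx'
  rw [one_div, one_div, inv_inj] at he
  have h1 := h.least.2 hy
  have h2 := h.greatest.2 hy
  have h3 := h.pos
  have h4 := h.lt_one
  have hij : i = j := by
    have e1 : (i : ℝ) < j + 1 := by linarith [hx.1]
    have e2 : (j : ℝ) < i + 1 := by linarith [hx.2]
    have e1 : i < j + 1 := by exact_mod_cast e1
    have e2 : j < i + 1 := by exact_mod_cast e2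
    omega
  subst hij
  rwa [add_left_cancel he]

lemma subset_Icc (h : Extremes k m M) : Cbk k [] ⊆ Icc m M :=
  fun _ hx => ⟨h.least.2 hx, h.greatest.2 hx⟩

/-- Every gap of `C(∅,k)` either separates two of the `k` pieces `1 / (i + C(∅,k))`, or is the
image of a gap under the parametrization of one piece. -/
lemma isGap_cases (h : Extremes k m M) {u v : ℝ} (hg : IsGap (Cbk k []) u v) :
    (∃ j : ℕ, 1 ≤ j ∧ j + 1 ≤ k ∧ u = 1 / ((j : ℝ) + 1 + m) ∧ v = 1 / (j + M)) ∨
    ∃ (i : ℕ) (x y : ℝ), 1 ≤ i ∧ i ≤ k ∧ IsGap (Cbk k []) x y ∧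
      u = 1 / ((i : ℝ) + y) ∧ v = 1 / (i + x) := by
  have hm := h.pos
  have hM := h.lt_one
  have hlt := h.lt
  obtain ⟨i, hi, hik, s, hs, hu⟩ := mem_Cbk_nil.1 hg.2.1
  obtain ⟨j, hj, hjk, t, ht, hv⟩ := mem_Cbk_nil.1 hg.2.2.1
  have hs' := h.subset_Icc hs
  have ht' := h.subset_Icc ht
  have hi' : (1 : ℝ) ≤ i := by exact_mod_cast hi
  have hj' : (1 : ℝ) ≤ j := by exact_mod_cast hj
  have hlt' : (j : ℝ) + t < i + s := by
    have := hg.1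
    rw [hu, hv] at this
    exact (one_div_lt_one_div (by linarith [hs'.1]) (by linarith [ht'.1])).1 this
  have hno : ∀ (n : ℕ) (z : ℝ), 1 ≤ n → n ≤ k → z ∈ Cbk k [] → (j : ℝ) + t < n + z →
      (n : ℝ) + z < i + s → False := by
    intro n z hn hnk hz h1 h2
    refine eq_empty_iff_forall_notMem.1 hg.2.2.2 (1 / (n + z))
      ⟨⟨?_, ?_⟩, mem_Cbk_nil.2 ⟨n, hn, hnk, z, hz, rfl⟩⟩
    · rw [hu]
      exact one_div_lt_one_div_of_lt (by linarith [ht'.1]) h2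
    · rw [hv]
      exact one_div_lt_one_div_of_lt (by linarith [ht'.1]) h1
  have hji : j ≤ i := by
    by_contra! hc
    have : (i : ℝ) + 1 ≤ j := by exact_mod_cast hc
    linarith [hs'.2, ht'.1]
  rcases hji.eq_or_lt with rfl | hji
  · right
    obtain ⟨x, y, h1, h2, -, -, h3⟩ := hg.exists_of_one_div_add hi' hm.le (hm.trans hlt).le
      (h.one_div_mem_iff hi hik)
      (by rw [hu]; exact one_div_le_one_div_of_le (by linarith [hs'.1]) (by linarith [hs'.2]))
      (by rw [hv]; exact one_div_le_one_div_of_le (by linarith) (by linarith [ht'.1]))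
    exact ⟨j, x, y, hi, hik, h3, h1, h2⟩
  · left
    have hij : i = j + 1 := by
      by_contra hne
      have hc : j + 1 + 1 ≤ i := by omega
      have hc : (j : ℝ) + 1 + 1 ≤ i := by exact_mod_cast hc
      exact hno (j + 1) m (by omega) (by omega) h.least.1
        (by push_cast; linarith [ht'.2]) (by push_cast; linarith [hs'.1])
    subst hij
    push_cast at hu hno
    have hsm : s = m := by
      by_contra hne
      have : m < s := lt_of_le_of_ne hs'.1 (Ne.symm hne)
      exact hno (j + 1) m (by omega) hik h.least.1
        (by push_cast; linarith [ht'.2]) (by push_cast; linarith)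
    have htM : t = M := by
      by_contra hne
      have : t < M := lt_of_le_of_ne ht'.2 hne
      exact hno j M hj hjk h.greatest.1 (by linarith) (by linarith [hs'.1])
    exact ⟨j, hj, hik, by rw [hu, hsm], by rw [hv, htM]⟩

lemma isGap_induction (h : Extremes k m M) {P : ℝ → ℝ → Prop}
    (base : ∀ j : ℕ, 1 ≤ j → j + 1 ≤ k → P (1 / ((j : ℝ) + 1 + m)) (1 / (j + M)))
    (step : ∀ (i : ℕ) (x y : ℝ), 1 ≤ i → i ≤ k → IsGap (Cbk k []) x y → P x y →
      P (1 / ((i : ℝ) + y)) (1 / (i + x)))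
    {u v : ℝ} (hg : IsGap (Cbk k []) u v) : P u v := by
  have hm := h.pos
  have key : ∀ (n : ℕ) (u v : ℝ), IsGap (Cbk k []) u v → 1 < (v - u) * ((1 + m) ^ 2) ^ n →
      P u v := by
    intro n
    induction n with
    | zero =>
      intro u v hg hn
      have h1 := h.subset_Icc hg.2.1
      have h2 := h.subset_Icc hg.2.2.1
      linarith [h1.1, h2.2, h.lt_one]
    | succ n ih =>
      intro u v hg hn
      rcases h.isGap_cases hg with ⟨j, hj, hjk, rfl, rfl⟩ | ⟨i, x, y, hi, hik, hxy, rfl, rfl⟩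
      · exact base j hj hjk
      · refine step i x y hi hik hxy (ih x y hxy (hn.trans_le ?_))
        have hi' : (1 : ℝ) ≤ i := by exact_mod_cast hi
        have hx := (h.subset_Icc hxy.2.1).1
        have hy := (h.subset_Icc hxy.2.2.1).1
        have hl : 1 / ((i : ℝ) + x) - 1 / (i + y) = (y - x) / ((i + x) * (i + y)) := by
          rw [div_sub_div _ _ (by linarith) (by linarith)]
          ring
        have hp : (1 + m) ^ 2 ≤ ((i : ℝ) + x) * (i + y) := by
          rw [sq]
          exact mul_le_mul (by linarith) (by linarith) (by linarith) (by linarith)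
        have hp0 : 0 < ((i : ℝ) + x) * (i + y) := lt_of_lt_of_le (by positivity) hp
        rw [pow_succ', ← mul_assoc]
        refine mul_le_mul_of_nonneg_right ?_ (by positivity)
        rw [hl, div_mul_eq_mul_div, div_le_iff₀ hp0]
        exact mul_le_mul_of_nonneg_left hp (sub_nonneg.2 hxy.1.le)
  obtain ⟨n, hn⟩ := pow_unbounded_of_one_lt (1 / (v - u)) (by nlinarith : 1 < (1 + m) ^ 2)
  refine key n u v hg ?_
  rwa [div_lt_iff₀ (sub_pos.2 hg.1), mul_comm] at hn

lemma gap_mul_le (h : Extremes k m M) {u v : ℝ} (hg : IsGap (Cbk k []) u v) :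
    (v - u) * ((1 + M) * (2 + m)) ≤ 1 + m - M := by
  have hm := h.pos
  have hM := h.lt_one
  have hlt := h.lt
  refine h.isGap_induction (P := fun u v => (v - u) * ((1 + M) * (2 + m)) ≤ 1 + m - M) ?_ ?_ hg
  · intro j hj _
    have hj' : (1 : ℝ) ≤ j := by exact_mod_cast hj
    have hl : 1 / ((j : ℝ) + M) - 1 / (j + 1 + m) = (1 + m - M) / ((j + M) * (j + 1 + m)) := by
      rw [div_sub_div _ _ (by linarith) (by linarith)]
      ring
    have hM0 : 0 < M := hm.trans hlt
    rw [hl, div_mul_eq_mul_div, div_le_iff₀ (by positivity)]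
    refine mul_le_mul_of_nonneg_left ?_ (by linarith)
    exact mul_le_mul (by linarith) (by linarith) (by linarith) (by linarith)
  · intro i x y hi _ hxy ih
    refine le_trans (mul_le_mul_of_nonneg_right ?_ ?_) ih
    · have hi' : (1 : ℝ) ≤ i := by exact_mod_cast hi
      have hx := (h.subset_Icc hxy.2.1).1
      have hy := (h.subset_Icc hxy.2.2.1).1
      have hl : 1 / ((i : ℝ) + x) - 1 / (i + y) = (y - x) / ((i + x) * (i + y)) := by
        rw [div_sub_div _ _ (by linarith) (by linarith)]
        ring
      rw [hl]
      exact div_le_self (sub_nonneg.2 hxy.1.le) (by nlinarith)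
    · exact mul_nonneg (by linarith) (by linarith)

lemma numeric_bounds (h : Extremes k m M) (hk : 4 ≤ k) : m < 0.2072 ∧ 0.8283 < M := by
  have hm := h.pos
  have h1 := h.mul_max
  have h2 := h.mul_min
  have hk' : (4 : ℝ) ≤ k := by exact_mod_cast hk
  have h3 : m < 0.2072 := by
    have hM : 4 * m ≤ M := by nlinarith
    by_contra! hc
    nlinarith [mul_le_mul_of_nonneg_right hM (by linarith : 0 ≤ 1 + m)]
  exact ⟨h3, by nlinarith⟩

lemma hasBridges_base (h : Extremes k m M) (hk : 4 ≤ k) {β : ℝ} (hβ : 0 ≤ β) {j : ℕ} (hj : 1 ≤ j)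
    (hjk : j + 1 ≤ k) :
    HasBridges 1.05 β (Cbk k []) (1 / ((j : ℝ) + 1 + m)) (1 / (j + M)) := by
  have hm := h.pos
  have hM := h.lt_one
  have hlt := h.lt
  have hM0 : 0 < M := hm.trans hlt
  have hj' : (1 : ℝ) ≤ j := by exact_mod_cast hj
  obtain ⟨hm1, hM1⟩ := h.numeric_bounds hk
  have hU : mobiusLen β (1 / ((j : ℝ) + 1 + m)) (1 / (j + M))
      = (1 + m - M) / ((j + β + M) * (j + β + (1 + m))) := by
    rw [add_assoc, mobiusLen_inv_add hj' hβ hM0.le (by linarith)]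
  have hL : mobiusLen β (1 / ((j : ℝ) + 1 + M)) (1 / (j + 1 + m))
      = (M - m) / ((j + 1 + β + m) * (j + 1 + β + M)) :=
    mobiusLen_inv_add (by linarith) hβ hm.le hM0.le
  have hR : mobiusLen β (1 / ((j : ℝ) + M)) (1 / (j + m))
      = (M - m) / ((j + β + m) * (j + β + M)) := mobiusLen_inv_add hj' hβ hm.le hM0.le
  have hc : 1 ≤ (j : ℝ) + β := by linarith
  have hsucc : ((j + 1 : ℕ) : ℝ) = j + 1 := by push_cast; rfl
  refine ⟨1 / ((j : ℝ) + 1 + M), ?_, 1 / (j + m), ?_, ?_, ?_, ?_, ?_, ?_, ?_⟩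
  · exact mem_Cbk_nil.2 ⟨j + 1, by omega, hjk, M, h.greatest.1, by rw [hsucc]⟩
  · exact mem_Cbk_nil.2 ⟨j, hj, by omega, m, h.least.1, rfl⟩
  · exact one_div_le_one_div_of_le (by linarith) (by linarith)
  · exact one_div_le_one_div_of_le (by linarith) (by linarith)
  · intro c d hcd hc' hd'
    have hi := h.one_div_mem_iff (i := j + 1) (by omega) hjk
    rw [hsucc] at hi
    obtain ⟨x, y, rfl, rfl, hx, hy, hxy⟩ := hcd.exists_of_one_div_add (by linarith) hm.le hM0.le
      hi hc' hd'
    have hle := h.gap_mul_le hxy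
    have hxy' := hxy.1
    rw [hU, mobiusLen_inv_add (by linarith) hβ (by linarith) (by linarith)]
    refine div_lt_div₀ ?_ ?_ (by linarith) (by positivity)
    · refine (lt_mul_of_one_lt_right (sub_pos.2 hxy') ?_).trans_le hle
      nlinarith
    · rw [mul_comm]
      exact mul_le_mul (by linarith) (by linarith) (by linarith) (by linarith)
  · intro c d hcd hc' hd'
    obtain ⟨x, y, rfl, rfl, hx, hy, hxy⟩ := hcd.exists_of_one_div_add hj' hm.le hM0.le
      (h.one_div_mem_iff hj (by omega)) hc' hd'
    have hle := h.gap_mul_le hxy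
    have hxy' := hxy.1
    rw [hU, mobiusLen_inv_add hj' hβ (by linarith) (by linarith)]
    generalize (j : ℝ) + β = c at hc
    rw [div_lt_div_iff₀ (mul_pos (by linarith) (by linarith)) (by positivity)]
    have e1 : (c + M) * (1 + m) ≤ (1 + M) * (c + m) := by nlinarith
    have e2 : (c + (1 + m)) * (1 + m) ≤ (2 + m) * (c + m) := by nlinarith
    have e3 : ((c + M) * (1 + m)) * ((c + (1 + m)) * (1 + m))
        ≤ ((1 + M) * (c + m)) * ((2 + m) * (c + m)) :=
      mul_le_mul e1 e2 (by positivity) (by positivity)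
    have e4 : (c + m) * (c + m) ≤ (c + x) * (c + y) :=
      mul_le_mul (by linarith) (by linarith) (by linarith) (by linarith)
    have e5 : (y - x) * ((c + M) * (c + (1 + m))) * (1 + m) ^ 2
        ≤ (1 + m - M) * ((c + x) * (c + y)) := by
      calc (y - x) * ((c + M) * (c + (1 + m))) * (1 + m) ^ 2
          = (y - x) * (((c + M) * (1 + m)) * ((c + (1 + m)) * (1 + m))) := by ring
        _ ≤ (y - x) * (((1 + M) * (c + m)) * ((2 + m) * (c + m))) :=
          mul_le_mul_of_nonneg_left e3 (by linarith)
        _ = ((y - x) * ((1 + M) * (2 + m))) * ((c + m) * (c + m)) := by ring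
        _ ≤ (1 + m - M) * ((c + x) * (c + y)) :=
          mul_le_mul hle e4 (by positivity) (by linarith)
    refine lt_of_lt_of_le ?_ e5
    refine lt_mul_of_one_lt_right ?_ (by nlinarith)
    exact mul_pos (by linarith) (by positivity)
  · rw [hU, hL]
    generalize hcβ : (j : ℝ) + β = c at hc
    have e : (j : ℝ) + 1 + β = c + 1 := by linarith
    rw [e, ← mul_div_assoc, div_le_div_iff₀ (by positivity) (by positivity)]
    have e1 : 1.05 * (1 + m - M) * (c + 1 + M) ≤ (M - m) * (c + M) := by nlinarith
    nlinarith [mul_le_mul_of_nonneg_right e1 (by linarith : 0 ≤ c + 1 + m)]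
  · rw [hU, hR]
    generalize (j : ℝ) + β = c at hc
    rw [← mul_div_assoc]
    refine div_le_div₀ (by linarith) (by linarith) (by positivity) ?_
    rw [mul_comm]
    exact mul_le_mul_of_nonneg_left (by linarith) (by linarith)

lemma hasBridges (h : Extremes k m M) (hk : 4 ≤ k) {u v : ℝ} (hg : IsGap (Cbk k []) u v) :
    ∀ β, 0 ≤ β → HasBridges 1.05 β (Cbk k []) u v := by
  refine h.isGap_induction (P := fun u v => ∀ β, 0 ≤ β → HasBridges 1.05 β (Cbk k []) u v)
    ?_ ?_ hg
  · exact fun j hj hjk β hβ => h.hasBridges_base hk hβ hj hjk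
  · intro i x y hi hik hxy ih β hβ
    exact HasBridges.one_div_add (by exact_mod_cast hi) hβ h.pos.le (h.pos.trans h.lt).le
      h.subset_Icc (h.one_div_mem_iff hi hik) hxy (ih _ (by positivity))

end Extremes

lemma hasBridges_Cbk {k : ℕ} (hk : 4 ≤ k) {b : List ℕ} (hb : ∀ d ∈ b, 1 ≤ d) :
    ∀ {u v : ℝ}, IsGap (Cbk k b) u v → ∀ β, 0 ≤ β → HasBridges 1.05 β (Cbk k b) u v := by
  induction b with
  | nil =>
    obtain ⟨m, M, h⟩ := exists_extremes (by omega : 2 ≤ k)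
    exact fun hg => h.hasBridges hk hg
  | cons a b ih =>
    intro u v hg β hβ
    have ha : 1 ≤ a := hb a (by simp)
    have hb' : ∀ d ∈ b, 1 ≤ d := fun d hd => hb d (by simp [hd])
    have ha' : (1 : ℝ) ≤ a := by exact_mod_cast ha
    have hI := Cbk_subset_Icc (k := k) hb'
    have hK : ∀ x ∈ Icc (0 : ℝ) 1, 1 / ((a : ℝ) + x) ∈ Cbk k (a :: b) ↔ x ∈ Cbk k b := by
      intro x _
      refine ⟨fun hx => ?_, fun hx => (mem_Cbk_cons ha hb').2 ⟨x, hx, rfl⟩⟩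
      obtain ⟨y, hy, he⟩ := (mem_Cbk_cons ha hb').1 hx
      rw [one_div, one_div, inv_inj] at he
      rwa [add_left_cancel he]
    obtain ⟨s, hs, hu⟩ := (mem_Cbk_cons ha hb').1 hg.2.1
    obtain ⟨t, ht, hv⟩ := (mem_Cbk_cons ha hb').1 hg.2.2.1
    obtain ⟨x, y, rfl, rfl, -, -, hxy⟩ := hg.exists_of_one_div_add ha' le_rfl zero_le_one hK
      (by rw [hu]; exact one_div_le_one_div_of_le (by linarith [(hI hs).1])
            (by linarith [(hI hs).2]))
      (by rw [hv]; exact one_div_le_one_div_of_le (by linarith) (by linarith [(hI ht).1]))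
    exact HasBridges.one_div_add ha' hβ le_rfl zero_le_one hI hK hxy
      (ih hb' hxy _ (by positivity))

/-- For every integer `k ≥ 4` and every finite (possibly empty) word `b` of positive
integers, `C(b,k)` is a Cantor set of thickness greater than `1`. -/
theorem Cbk_thickness (k : ℕ) (hk : 4 ≤ k) (b : List ℕ) (hb : ∀ d ∈ b, 1 ≤ d) :
    IsCantorSet (Cbk k b) ∧ 1 < thickness (Cbk k b) := by
  have hC := isCompact_Cbk k hb
  refine ⟨isCantorSet_Cbk (by omega) hb, lt_of_lt_of_le (by norm_num : (1 : ℝ) < 1.05) ?_⟩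
  refine le_thickness hC ?_ fun u v hg => hasBridges_Cbk hk hb hg 0 le_rfl
  obtain ⟨x, hx⟩ := Cbk_nonempty (by omega : 1 ≤ k) b
  obtain ⟨y, hy, hne, -⟩ := exists_ne_mem_Cbk (by omega : 2 ≤ k) hb hx one_pos
  wlog hlt : x < y generalizing x y
  · exact this y hy x hx hne.symm (lt_of_le_of_ne (not_lt.1 hlt) hne)
  obtain ⟨q, hq1, hq2⟩ := exists_rat_btwn hlt
  exact exists_isGap hC hx hy hq1 hq2 fun hq => irrational_of_mem_Cbk hb hq ⟨q, rfl⟩
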